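/- Assume the solution is nontrivial (S is not a horizontal line) and u² + v² ≠ 0 at every point of the closure of Ω. If in addition ω u + g ≥ 0 throughout Ω, then P ≥ Patm on the closure of Ω with equality only at points of the free surface S, and moreover ∂P/∂n < 0 at every point of S. -/

import Mathlib

open Set

/-- Partial derivative in the horizontal direction. -/
noncomputable def pdX (f : ℝ × ℝ → ℝ) (p : ℝ × ℝ) : ℝ := fderiv ℝ f p (1, 0)

/-- Partial derivative in the vertical direction. -/
noncomputable def pdY (f : ℝ × ℝ → ℝ) (p : ℝ × ℝ) : ℝ := fderiv ℝ f p (0, 1)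

/-- A general (possibly overturning, possibly asymmetric) horizontally `2L`-periodic
steady water wave.  The free surface `S` is the non-self-intersecting `C²` curve
parametrized by `s ↦ (X s, Y s)`, lying above the bed `B = {y = -d}`, and the fluid
domain `Ω` is the open connected `2L`-periodic region whose boundary is `S ∪ B`.
The flow `(u, v)` with pressure `P` solves the steady Euler equations in `Ω`, is
tangent to `S`, has `P = Patm` on `S` and `v = 0` on `B`; `ψ` is a stream function,
vanishing on `S` and equal to the constant `m` on `B`. -/
structure GenPeriodicFlow (g Patm L d : ℝ) : Type where
  X : ℝ → ℝ
  Y : ℝ → ℝ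
  T : ℝ
  u : ℝ × ℝ → ℝ
  v : ℝ × ℝ → ℝ
  P : ℝ × ℝ → ℝ
  ψ : ℝ × ℝ → ℝ
  m : ℝ
  Ω : Set (ℝ × ℝ)
  T_pos : 0 < T
  X_smooth : ContDiff ℝ 2 X
  Y_smooth : ContDiff ℝ 2 Y
  regular : ∀ s, deriv X s ^ 2 + deriv Y s ^ 2 ≠ 0
  X_per : ∀ s, X (s + T) = X s + 2 * L
  Y_per : ∀ s, Y (s + T) = Y s
  S_above_bed : ∀ s, -d < Y s
  S_simple : ∀ s s', X s = X s' → Y s = Y s' → ∃ n : ℤ, s' = s + n * T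
  Ω_open : IsOpen Ω
  Ω_conn : IsConnected Ω
  Ω_per : ∀ p : ℝ × ℝ, p ∈ Ω ↔ (p.1 + 2 * L, p.2) ∈ Ω
  Ω_frontier : frontier Ω = (range fun s => (X s, Y s)) ∪ {p : ℝ × ℝ | p.2 = -d}
  u_smooth : ContDiff ℝ 1 u
  v_smooth : ContDiff ℝ 1 v
  P_smooth : ContDiff ℝ 2 P
  ψ_smooth : ContDiff ℝ 2 ψ
  u_periodic : ∀ x y, u (x + 2 * L, y) = u (x, y)
  v_periodic : ∀ x y, v (x + 2 * L, y) = v (x, y)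
  P_periodic : ∀ x y, P (x + 2 * L, y) = P (x, y)
  euler_x : ∀ p ∈ Ω, u p * pdX u p + v p * pdY u p = -pdX P p
  euler_y : ∀ p ∈ Ω, u p * pdX v p + v p * pdY v p = -(pdY P p) - g
  incompressible : ∀ p ∈ Ω, pdX u p + pdY v p = 0
  surface_pressure : ∀ s, P (X s, Y s) = Patm
  surface_tangency : ∀ s, u (X s, Y s) * deriv Y s = v (X s, Y s) * deriv X s
  bed_kinematic : ∀ x, v (x, -d) = 0
  psi_x : ∀ p ∈ closure Ω, pdX ψ p = -v p
  psi_y : ∀ p ∈ closure Ω, pdY ψ p = u p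
  psi_surface : ∀ s, ψ (X s, Y s) = 0
  psi_bed : ∀ x, ψ (x, -d) = m

namespace GenPeriodicFlow

variable {g Patm L d : ℝ}

/-- The vorticity `ω = v_x - u_y`. -/
noncomputable def vort (F : GenPeriodicFlow g Patm L d) (p : ℝ × ℝ) : ℝ :=
  pdX F.v p - pdY F.u p

/-- The free surface `S`, as a subset of the plane. -/
def surf (F : GenPeriodicFlow g Patm L d) : Set (ℝ × ℝ) :=
  range fun s => (F.X s, F.Y s)

/-- The maximal surface height `maxη = max_S y`. -/
noncomputable def maxη (F : GenPeriodicFlow g Patm L d) : ℝ := sSup (range F.Y)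

/-- The minimal surface height `minη = min_S y`. -/
noncomputable def minη (F : GenPeriodicFlow g Patm L d) : ℝ := sInf (range F.Y)

/-- The solution is nontrivial: `S` is not a horizontal line. -/
def Nontrivial' (F : GenPeriodicFlow g Patm L d) : Prop := ∃ s s', F.Y s ≠ F.Y s'

/-- `n` is an outward (non-fluid side) normal to `S` at the parameter `s`:
it is orthogonal to the tangent vector and points out of the fluid. -/
def IsOutwardNormalAt (F : GenPeriodicFlow g Patm L d) (n : ℝ × ℝ) (s : ℝ) : Prop :=
  n.1 * deriv F.X s + n.2 * deriv F.Y s = 0 ∧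
  ∃ t₀ > 0, ∀ t, 0 < t → t < t₀ → (F.X s + t * n.1, F.Y s + t * n.2) ∉ closure F.Ω

end GenPeriodicFlow

open Filter Topology in
theorem nonneg_of_isLocalMin_of_hasDerivAt_hasDerivAt {f f' : ℝ → ℝ} {a c : ℝ}
    (hf : ∀ᶠ t in 𝓝 a, HasDerivAt f (f' t) t) (hf' : HasDerivAt f' c a)
    (hmin : IsLocalMin f a) : 0 ≤ c := by
  by_contra! hc
  have hd : deriv f =ᶠ[𝓝 a] f' := hf.mono fun t ht => ht.deriv
  have h2 : deriv (deriv f) a = c := by rw [hd.deriv_eq]; exact hf'.deriv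
  have hmax : IsLocalMax f a := isLocalMax_of_deriv_deriv_neg (h2 ▸ hc) hmin.deriv_eq_zero
    hf.self_of_nhds.continuousAt
  have hcst : f =ᶠ[𝓝 a] fun _ => f a := by
    filter_upwards [hmin, hmax] with t h1 h2
    exact le_antisymm h2 h1
  have h3 := hcst.deriv.deriv_eq
  simp only [deriv_const', h2] at h3
  linarith

theorem integral_logDeriv_eq_zero_of_mem_slitPlane {f f' : ℝ → ℂ} {T : ℝ}
    (hf : ∀ s ∈ uIcc 0 T, HasDerivAt f (f' s) s) (hf' : ContinuousOn f' (uIcc 0 T))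
    (hT : f T = f 0) (hs : ∀ s ∈ uIcc 0 T, f s ∈ Complex.slitPlane) :
    ∫ s in (0 : ℝ)..T, f' s / f s = 0 := by
  have hc : ContinuousOn f (uIcc 0 T) := fun s h => (hf s h).continuousAt.continuousWithinAt
  rw [intervalIntegral.integral_eq_sub_of_hasDerivAt
    (f := fun s => Complex.log (f s)) (fun s h => (hf s h).clog_real (hs s h))
    ((hf'.div hc fun s h => Complex.slitPlane_ne_zero (hs s h)).intervalIntegrable), hT, sub_self]

/-- The winding integral of a closed loop takes the same value at `z` and at any point closer to `z`
than the loop is. -/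
theorem integral_div_sub_eq_of_norm_lt {c c' : ℝ → ℂ} {T : ℝ} {z w : ℂ}
    (hc : ∀ s, HasDerivAt c (c' s) s) (hc' : Continuous c') (hT : c T = c 0)
    (h : ∀ s ∈ uIcc 0 T, ‖w - z‖ < ‖c s - z‖) :
    ∫ s in (0 : ℝ)..T, c' s / (c s - w) = ∫ s in (0 : ℝ)..T, c' s / (c s - z) := by
  have hcc : Continuous c := continuous_iff_continuousAt.2 fun s => (hc s).continuousAt
  have hz : ∀ s ∈ uIcc 0 T, c s - z ≠ 0 := fun s hs h0 => by
    have := h s hs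
    rw [h0, norm_zero] at this
    exact absurd this (not_lt.2 (norm_nonneg _))
  have hw : ∀ s ∈ uIcc 0 T, c s - w ≠ 0 := fun s hs h0 => by
    have := h s hs
    rw [← sub_eq_zero.1 h0] at this
    exact lt_irrefl _ this
  have hf := integral_logDeriv_eq_zero_of_mem_slitPlane
    (f := fun s => (c s - w) / (c s - z))
    (f' := fun s => (c' s * (c s - z) - (c s - w) * c' s) / (c s - z) ^ 2) (T := T)
    (fun s hs => ((hc s).sub_const w).div ((hc s).sub_const z) (hz s hs))
    (ContinuousOn.div (by fun_prop) (by fun_prop) fun s hs => pow_ne_zero 2 (hz s hs))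
    (by simp only [hT]) fun s hs => by
      have : (c s - w) / (c s - z) = 1 + -(w - z) / (c s - z) := by
        field_simp [hz s hs]; ring
      rw [this]
      apply Complex.mem_slitPlane_of_norm_lt_one
      rw [norm_div, norm_neg]
      exact (div_lt_one (norm_pos_iff.2 (hz s hs))).2 (h s hs)
  rw [← sub_eq_zero, ← intervalIntegral.integral_sub, ← hf]
  · refine intervalIntegral.integral_congr fun s hs => ?_
    have h1 := hz s hs
    have h2 := hw s hs
    field_simp
  · exact ContinuousOn.intervalIntegrable
      (ContinuousOn.div (by fun_prop) (by fun_prop) hw)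
  · exact ContinuousOn.intervalIntegrable
      (ContinuousOn.div (by fun_prop) (by fun_prop) hz)

theorem integral_div_sub_eq_zero_of_norm_lt {c c' : ℝ → ℂ} {T : ℝ} {z : ℂ}
    (hc : ∀ s, HasDerivAt c (c' s) s) (hc' : Continuous c') (hT : c T = c 0)
    (h : ∀ s ∈ uIcc 0 T, ‖c s‖ < ‖z‖) :
    ∫ s in (0 : ℝ)..T, c' s / (c s - z) = 0 := by
  have hz : z ≠ 0 := norm_pos_iff.1 ((norm_nonneg _).trans_lt (h 0 left_mem_uIcc))
  have hw : ∀ s ∈ uIcc 0 T, c s - z ≠ 0 := fun s hs h0 => by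
    have := h s hs
    rw [← sub_eq_zero.1 h0] at this
    exact lt_irrefl _ this
  rw [← integral_logDeriv_eq_zero_of_mem_slitPlane
    (f := fun s => 1 + -(c s) / z)
    (f' := fun s => -(c' s) / z) (T := T)
    (fun s hs => ((hc s).neg.div_const z).const_add 1)
    (by fun_prop)
    (by simp only [hT]) fun s hs => by
      apply Complex.mem_slitPlane_of_norm_lt_one
      rw [norm_div, norm_neg]
      exact (div_lt_one (norm_pos_iff.2 hz)).2 (h s hs)]
  refine intervalIntegral.integral_congr fun s hs => ?_
  have h2 := hw s hs
  have h3 : z - c s ≠ 0 := fun h => h2 (by rw [← neg_sub, h, neg_zero])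
  have h4 : 1 + -(c s) / z = (z - c s) / z := by field_simp; ring
  simp only [h4]
  field_simp
  ring

/-- Symmetry of second derivatives for a function of two real variables whose partial derivatives
are merely differentiable at the point. -/
theorem mixed_partials_eq {f p q : ℝ × ℝ → ℝ} {a : ℝ × ℝ} {p' q' : ℝ × ℝ →L[ℝ] ℝ}
    (hf : Differentiable ℝ f)
    (hp : (fun x => fderiv ℝ f x (1, 0)) =ᶠ[nhds a] p) (hq : (fun x => fderiv ℝ f x (0, 1)) =ᶠ[nhds a] q)
    (hp' : HasFDerivAt p p' a) (hq' : HasFDerivAt q q' a) : p' (0, 1) = q' (1, 0) := by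
  let e1 := ContinuousLinearMap.fst ℝ ℝ ℝ
  let e2 := ContinuousLinearMap.snd ℝ ℝ ℝ
  have h : HasFDerivAt (fderiv ℝ f) (p'.smulRight e1 + q'.smulRight e2) a := by
    refine ((hp'.smul_const e1).add (hq'.smul_const e2)).congr_of_eventuallyEq ?_
    filter_upwards [hp, hq] with x h1 h2
    ext <;> simp [e1, e2, ← h1, ← h2]
  have := second_derivative_symmetric (fun y => (hf y).hasFDerivAt) h (1, 0) (0, 1)
  simpa [e1, e2] using this.symm

namespace GenPeriodicFlow

variable {g Patm L d : ℝ}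

theorem Y_add_int_mul (F : GenPeriodicFlow g Patm L d) (s : ℝ) (n : ℤ) :
    F.Y (s + n * F.T) = F.Y s :=
  (show Function.Periodic F.Y F.T from F.Y_per).int_mul n s

theorem X_add_int_mul (F : GenPeriodicFlow g Patm L d) (s : ℝ) (n : ℤ) :
    F.X (s + n * F.T) = F.X s + 2 * L * n := by
  have hT := F.T_pos.ne'
  have h : Function.Periodic (fun s => F.X s - 2 * L / F.T * s) F.T := fun s => by
    simp only [F.X_per]
    field_simp
    ring
  have := h.int_mul n s
  field_simp at this
  refine mul_left_cancel₀ hT ?_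
  linear_combination this

theorem notMem_of_mem_frontier (F : GenPeriodicFlow g Patm L d) {p : ℝ × ℝ}
    (hp : p ∈ frontier F.Ω) : p ∉ F.Ω := fun h => by
  rw [F.Ω_open.frontier_eq] at hp
  exact hp.2 h

theorem surf_mem_frontier (F : GenPeriodicFlow g Patm L d) (s : ℝ) :
    (F.X s, F.Y s) ∈ frontier F.Ω := by
  rw [F.Ω_frontier]; exact Or.inl ⟨s, rfl⟩

theorem bed_mem_frontier (F : GenPeriodicFlow g Patm L d) (x : ℝ) :
    (x, -d) ∈ frontier F.Ω := by
  rw [F.Ω_frontier]; exact Or.inr rfl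

theorem mem_closure_cases (F : GenPeriodicFlow g Patm L d) {p : ℝ × ℝ} (hp : p ∈ closure F.Ω) :
    p ∈ F.Ω ∨ (∃ s, p = (F.X s, F.Y s)) ∨ p.2 = -d := by
  by_cases h : p ∈ F.Ω
  · exact Or.inl h
  · have : p ∈ frontier F.Ω := by rw [F.Ω_open.frontier_eq]; exact ⟨hp, h⟩
    rw [F.Ω_frontier] at this
    rcases this with ⟨s, hs⟩ | h
    · exact Or.inr (Or.inl ⟨s, hs.symm⟩)
    · exact Or.inr (Or.inr h)

theorem subset_of_isPreconnected (F : GenPeriodicFlow g Patm L d) {C : Set (ℝ × ℝ)}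
    (hC : IsPreconnected C) (hne : (C ∩ F.Ω).Nonempty)
    (hS : ∀ p ∈ C, ∀ s, p ≠ (F.X s, F.Y s)) (hB : ∀ p ∈ C, p.2 ≠ -d) : C ⊆ F.Ω :=
  hC.subset_of_closure_inter_subset F.Ω_open hne fun p hp => by
    rcases F.mem_closure_cases hp.1 with h | ⟨s, h⟩ | h
    · exact h
    · exact absurd h (hS p hp.2 s)
    · exact absurd h (hB p hp.2)

theorem bed_lt (F : GenPeriodicFlow g Patm L d) {p : ℝ × ℝ} (hp : p ∈ F.Ω) : -d < p.2 := by
  by_contra! hle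
  have hne : ∀ q ∈ F.Ω, q.2 ≠ -d := fun q hq h =>
    F.notMem_of_mem_frontier (by simpa [← h] using F.bed_mem_frontier q.1) hq
  have hsub : F.Ω ⊆ {q : ℝ × ℝ | q.2 < -d} := by
    refine F.Ω_conn.isPreconnected.subset_of_closure_inter_subset
      (isOpen_lt continuous_snd continuous_const) ⟨p, hp, lt_of_le_of_ne hle (hne p hp)⟩ ?_
    rintro q ⟨hq1, hq2⟩
    exact lt_of_le_of_ne (closure_lt_subset_le continuous_snd continuous_const hq1) (hne q hq2)
  have h0 := closure_mono hsub (frontier_subset_closure (F.surf_mem_frontier 0))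
  have := closure_lt_subset_le continuous_snd continuous_const h0
  exact absurd (F.S_above_bed 0) (not_lt.2 this)

theorem bed_le (F : GenPeriodicFlow g Patm L d) {p : ℝ × ℝ} (hp : p ∈ closure F.Ω) : -d ≤ p.2 :=
  closure_minimal (t := {q : ℝ × ℝ | -d ≤ q.2}) (fun _ hq => (F.bed_lt hq).le)
    (isClosed_le continuous_const continuous_snd) hp

theorem exists_surf_bounds (F : GenPeriodicFlow g Patm L d) :
    ∃ lo hi, -d < lo ∧ ∀ s, lo ≤ F.Y s ∧ F.Y s ≤ hi := by
  have hc := F.Y_smooth.continuous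
  have hper : Function.Periodic F.Y F.T := F.Y_per
  obtain ⟨a, -, ha⟩ := isCompact_Icc.exists_isMinOn (nonempty_Icc.2 F.T_pos.le) hc.continuousOn
  obtain ⟨b, -, hb⟩ := isCompact_Icc.exists_isMaxOn (nonempty_Icc.2 F.T_pos.le) hc.continuousOn
  refine ⟨F.Y a, F.Y b, F.S_above_bed a, fun s => ?_⟩
  obtain ⟨t, ht, hst⟩ := hper.exists_mem_Ico₀ F.T_pos s
  rw [hst]
  exact ⟨ha ⟨ht.1, ht.2.le⟩, hb ⟨ht.1, ht.2.le⟩⟩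

/-- Every point strictly between the bed and the lowest surface level is in the fluid. -/
theorem mem_of_lt_surf (F : GenPeriodicFlow g Patm L d) {p : ℝ × ℝ} {lo : ℝ}
    (hlo : ∀ s, lo ≤ F.Y s) (h1 : -d < p.2) (h2 : p.2 < lo) : p ∈ F.Ω := by
  have hconv : Convex ℝ {q : ℝ × ℝ | -d < q.2 ∧ q.2 < lo} :=
    (convex_halfSpace_gt (LinearMap.snd ℝ ℝ ℝ).isLinear (-d)).inter
      (convex_halfSpace_lt (LinearMap.snd ℝ ℝ ℝ).isLinear lo)
  refine F.subset_of_isPreconnected hconv.isPreconnected ?_ ?_ (fun q hq => hq.1.ne') ⟨h1, h2⟩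
  · have hb := frontier_subset_closure (F.bed_mem_frontier 0)
    obtain ⟨q, hq1, hq2⟩ := mem_closure_iff.1 hb {q | q.2 < lo}
      (isOpen_lt continuous_snd continuous_const) (h1.trans h2)
    exact ⟨q, ⟨F.bed_lt hq2, hq1⟩, hq2⟩
  · rintro q hq s rfl
    exact absurd hq.2 (not_lt.2 (hlo s))

/-- The conformal map from the horizontally periodic plane to the punctured plane. -/
noncomputable def expMap (L : ℝ) (p : ℝ × ℝ) : ℂ :=
  Complex.exp ((p.1 + p.2 * Complex.I) * (Real.pi / L * Complex.I))

theorem norm_expMap (L : ℝ) (p : ℝ × ℝ) : ‖expMap L p‖ = Real.exp (-(Real.pi / L * p.2)) := by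
  have : (p.1 + p.2 * Complex.I) * (Real.pi / L * Complex.I)
      = ((-(Real.pi / L * p.2) : ℝ) : ℂ) + ((Real.pi / L * p.1 : ℝ) : ℂ) * Complex.I := by
    push_cast
    linear_combination (p.2 * (Real.pi / L) : ℂ) * Complex.I_sq
  rw [expMap, Complex.norm_exp, this]
  simp

theorem expMap_eq {L : ℝ} (hL : 0 < L) {p q : ℝ × ℝ} (h : expMap L p = expMap L q) :
    ∃ n : ℤ, p = (q.1 + 2 * L * n, q.2) := by
  obtain ⟨n, hn⟩ := Complex.exp_eq_exp_iff_exists_int.1 h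
  have hLc : (L : ℂ) ≠ 0 := by exact_mod_cast hL.ne'
  have hpi : (Real.pi : ℂ) ≠ 0 := by exact_mod_cast Real.pi_ne_zero
  field_simp at hn
  have hre := congrArg Complex.re hn
  have him := congrArg Complex.im hn
  simp at hre him
  refine ⟨n, Prod.ext ?_ him⟩
  simp only
  linarith

theorem expMap_ne_surf (F : GenPeriodicFlow g Patm L d) (hL : 0 < L) {p : ℝ × ℝ} (hp : p ∈ F.Ω)
    (s : ℝ) : expMap L (F.X s, F.Y s) ≠ expMap L p := fun h => by
  obtain ⟨n, hn⟩ := expMap_eq hL h.symm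
  refine F.notMem_of_mem_frontier (F.surf_mem_frontier (s + n * F.T)) ?_
  rwa [F.X_add_int_mul, F.Y_add_int_mul, ← hn]

/-- The free surface separates the region above it from the region below it. -/
theorem exists_surf_ge (F : GenPeriodicFlow g Patm L d) (hL : 0 < L) {p q : ℝ × ℝ}
    (hp : p ∈ F.Ω) (hq : q ∈ F.Ω) (hlow : ∀ s, p.2 < F.Y s) : ∃ s, q.2 ≤ F.Y s := by
  by_contra! hhigh
  set c : ℝ → ℂ := fun s => expMap L (F.X s, F.Y s) with hc_def
  set k : ℂ := Real.pi / L * Complex.I with hk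
  have hk0 : 0 < Real.pi / L := div_pos Real.pi_pos hL
  set e' : ℝ → ℂ := fun s => (deriv F.X s + deriv F.Y s * Complex.I) * k with he'
  have hX := F.X_smooth.continuous_deriv (by norm_num)
  have hY := F.Y_smooth.continuous_deriv (by norm_num)
  have he'c : Continuous e' := by fun_prop
  have hXd : ∀ s, HasDerivAt F.X (deriv F.X s) s :=
    fun s => (F.X_smooth.differentiable (by norm_num) s).hasDerivAt
  have hYd : ∀ s, HasDerivAt F.Y (deriv F.Y s) s :=
    fun s => (F.Y_smooth.differentiable (by norm_num) s).hasDerivAt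
  have he : ∀ s, HasDerivAt (fun s => ((F.X s : ℂ) + F.Y s * Complex.I) * k) (e' s) s := fun s =>
    ((hXd s).ofReal_comp.add ((hYd s).ofReal_comp.mul_const _)).mul_const _
  have hc : ∀ s, HasDerivAt c (c s * e' s) s := fun s => (he s).cexp
  have hcc : Continuous c := continuous_iff_continuousAt.2 fun s => (hc s).continuousAt
  have hc' : Continuous fun s => c s * e' s := hcc.mul he'c
  have hX0 : F.X F.T = F.X 0 + 2 * L := by simpa using F.X_per 0
  have hY0 : F.Y F.T = F.Y 0 := by simpa using F.Y_per 0
  have hLc : (L : ℂ) ≠ 0 := by exact_mod_cast hL.ne'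
  have hcT : c F.T = c 0 := by
    simp only [hc_def, expMap, hX0, hY0]
    refine Complex.exp_eq_exp_iff_exists_int.2 ⟨1, ?_⟩
    push_cast
    field_simp
    ring
  set G : ℂ → ℂ := fun z => ∫ s in (0 : ℝ)..F.T, c s * e' s / (c s - z) with hG
  have hlocal : ∀ r ∈ F.Ω, ∀ᶠ r' in nhds r, G (expMap L r') = G (expMap L r) := by
    intro r hr
    obtain ⟨s₀, -, hs₀⟩ := (isCompact_uIcc (a := (0 : ℝ)) (b := F.T)).exists_isMinOn
      nonempty_uIcc (f := fun s => ‖c s - expMap L r‖) (by fun_prop)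
    have hpos : 0 < ‖c s₀ - expMap L r‖ :=
      norm_pos_iff.2 (sub_ne_zero.2 (F.expMap_ne_surf hL hr s₀))
    have hcont : Continuous fun r' : ℝ × ℝ => ‖expMap L r' - expMap L r‖ := by
      unfold expMap; fun_prop
    have : ∀ᶠ r' in nhds r, ‖expMap L r' - expMap L r‖ < ‖c s₀ - expMap L r‖ :=
      hcont.continuousAt.eventually_lt continuousAt_const (by simpa using hpos)
    filter_upwards [this] with r' hr'
    exact integral_div_sub_eq_of_norm_lt hc hc' hcT fun s hs => hr'.trans_le (hs₀ hs)
  have hder : ∀ r ∈ F.Ω, HasFDerivAt (fun r => G (expMap L r)) (0 : ℝ × ℝ →L[ℝ] ℂ) r :=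
    fun r hr => (hasFDerivAt_const (G (expMap L r)) r).congr_of_eventuallyEq (hlocal r hr)
  have heq : G (expMap L p) = G (expMap L q) :=
    F.Ω_open.is_const_of_fderiv_eq_zero (𝕜 := ℝ) F.Ω_conn.isPreconnected
      (f := fun r => G (expMap L r))
      (fun r hr => (hder r hr).differentiableAt.differentiableWithinAt)
      (fun r hr => (hder r hr).fderiv) hp hq
  have hGp : G (expMap L p) = 0 := by
    refine integral_div_sub_eq_zero_of_norm_lt hc hc' hcT fun s _ => ?_
    simp only [hc_def, norm_expMap]
    have := mul_lt_mul_of_pos_left (hlow s) hk0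
    exact Real.exp_lt_exp.2 (by linarith)
  have hGq : G (expMap L q) = G 0 := by
    refine integral_div_sub_eq_of_norm_lt hc hc' hcT fun s _ => ?_
    simp only [hc_def, norm_expMap, sub_zero]
    have := mul_lt_mul_of_pos_left (hhigh s) hk0
    exact Real.exp_lt_exp.2 (by linarith)
  have hG0 : G 0 = 2 * Real.pi * Complex.I := by
    have : G 0 = ∫ s in (0 : ℝ)..F.T, e' s := by
      refine intervalIntegral.integral_congr fun s _ => ?_
      have : c s ≠ 0 := Complex.exp_ne_zero _
      simp only [sub_zero]
      field_simp
    rw [this, intervalIntegral.integral_eq_sub_of_hasDerivAt (fun s _ => he s)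
      (he'c.intervalIntegrable _ _), hX0, hY0, hk]
    push_cast
    field_simp
    ring
  have h2 : (2 * Real.pi * Complex.I : ℂ) = 0 := by rw [← hG0, ← hGq, ← heq, hGp]
  exact Complex.two_pi_I_ne_zero h2

theorem exists_le_of_mem_closure (F : GenPeriodicFlow g Patm L d) (hL : 0 < L) :
    ∃ hi, ∀ p ∈ closure F.Ω, p.2 ≤ hi := by
  obtain ⟨lo, hi, h0, h⟩ := F.exists_surf_bounds
  refine ⟨hi, fun p hp => closure_minimal (t := {q : ℝ × ℝ | q.2 ≤ hi}) (fun q hq => ?_)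
    (isClosed_le continuous_snd continuous_const) hp⟩
  have hm : ((0 : ℝ), (-d + lo) / 2) ∈ F.Ω :=
    F.mem_of_lt_surf (fun s => (h s).1) (by simp only; linarith) (by simp only; linarith)
  obtain ⟨s, hs⟩ := F.exists_surf_ge hL hm hq fun s => by
    have := (h s).1
    simp only; linarith
  exact hs.trans (h s).2

end GenPeriodicFlow

open Filter Topology in
theorem HasDerivAt.nonneg_of_eventually_right_le {h : ℝ → ℝ} {a c : ℝ} (hd : HasDerivAt h c a)
    (hge : ∀ᶠ t in 𝓝[>] (0 : ℝ), h a ≤ h (a + t)) : 0 ≤ c := by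
  refine ge_of_tendsto hd.tendsto_slope_zero_right ?_
  filter_upwards [hge, self_mem_nhdsWithin] with t ht ht0
  exact smul_nonneg (inv_nonneg.2 (le_of_lt ht0)) (sub_nonneg.2 ht)

open Filter Topology Asymptotics in
theorem HasFDerivAt.sub_const_mul_continuousAt {f k : ℝ × ℝ → ℝ} {f' : ℝ × ℝ →L[ℝ] ℝ} {a : ℝ × ℝ}
    (hf : HasFDerivAt f f' a) (hk : ContinuousAt k a) :
    HasFDerivAt (fun x => (f x - f a) * k x) (k a • f') a := by
  have h1 : (fun x => (f x - f a) * (k x - k a)) =o[𝓝 a] fun x => x - a := by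
    have h := hf.isBigO_sub.norm_right.mul_isLittleO
      ((isLittleO_one_iff ℝ).2 (tendsto_sub_nhds_zero_iff.2 hk))
    simp only [mul_one] at h
    exact h.of_norm_right
  have h2 : HasFDerivAt (fun x => (f x - f a) * (k x - k a)) (0 : ℝ × ℝ →L[ℝ] ℝ) a :=
    .of_isLittleO (by simpa using h1)
  refine (h2.add ((hf.sub_const (f a)).mul_const (k a))).congr_of_eventuallyEq ?_ |>.congr_fderiv ?_
  · exact .of_forall fun x => by simp only [Pi.add_apply]; ring
  · simp

theorem HasFDerivAt.hasDerivAt_fst {f : ℝ × ℝ → ℝ} {f' : ℝ × ℝ →L[ℝ] ℝ} {x y : ℝ}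
    (hf : HasFDerivAt f f' (x, y)) : HasDerivAt (fun t => f (t, y)) (f' (1, 0)) x :=
  hf.comp_hasDerivAt x ((hasDerivAt_id x).prodMk (hasDerivAt_const x y))

theorem HasFDerivAt.hasDerivAt_snd {f : ℝ × ℝ → ℝ} {f' : ℝ × ℝ →L[ℝ] ℝ} {x y : ℝ}
    (hf : HasFDerivAt f f' (x, y)) : HasDerivAt (fun t => f (x, t)) (f' (0, 1)) y :=
  hf.comp_hasDerivAt y ((hasDerivAt_const y x).prodMk (hasDerivAt_id y))

theorem fderiv_prod_apply (f : ℝ × ℝ → ℝ) (p n : ℝ × ℝ) :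
    fderiv ℝ f p n = n.1 * pdX f p + n.2 * pdY f p := by
  have : n = n.1 • ((1 : ℝ), (0 : ℝ)) + n.2 • ((0 : ℝ), (1 : ℝ)) := by ext <;> simp
  conv_lhs => rw [this]
  simp only [pdX, pdY, map_add, map_smul, smul_eq_mul]

theorem ContDiff.continuous_pdX {f : ℝ × ℝ → ℝ} (hf : ContDiff ℝ 1 f) : Continuous (pdX f) :=
  (hf.continuous_fderiv (by norm_num)).clm_apply continuous_const

theorem ContDiff.continuous_pdY {f : ℝ × ℝ → ℝ} (hf : ContDiff ℝ 1 f) : Continuous (pdY f) :=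
  (hf.continuous_fderiv (by norm_num)).clm_apply continuous_const

theorem ContDiff.differentiable_pdX {f : ℝ × ℝ → ℝ} (hf : ContDiff ℝ 2 f) :
    Differentiable ℝ (pdX f) :=
  ((hf.fderiv_right (m := 1) (by norm_num)).clm_apply contDiff_const).differentiable (by norm_num)

theorem ContDiff.differentiable_pdY {f : ℝ × ℝ → ℝ} (hf : ContDiff ℝ 2 f) :
    Differentiable ℝ (pdY f) :=
  ((hf.fderiv_right (m := 1) (by norm_num)).clm_apply contDiff_const).differentiable (by norm_num)

namespace GenPeriodicFlow

variable {g Patm L d : ℝ}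

/-- The pressure equation, valid pointwise although the velocity is only once differentiable. -/
theorem pressure_laplacian (F : GenPeriodicFlow g Patm L d) {p : ℝ × ℝ} (hp : p ∈ F.Ω) :
    pdX (pdX F.P) p + pdY (pdY F.P) p
      = 2 * (pdX F.u p * pdY F.v p - pdY F.u p * pdX F.v p) := by
  have hu := F.u_smooth.differentiable (by norm_num)
  have hv := F.v_smooth.differentiable (by norm_num)
  have hPx := (F.P_smooth.differentiable_pdX p).hasFDerivAt
  have hPy := (F.P_smooth.differentiable_pdY p).hasFDerivAt
  have hU := fun {k : ℝ × ℝ → ℝ} (hk : Continuous k) =>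
    (hu p).hasFDerivAt.sub_const_mul_continuousAt hk.continuousAt
  have hV := fun {k : ℝ × ℝ → ℝ} (hk : Continuous k) =>
    (hv p).hasFDerivAt.sub_const_mul_continuousAt hk.continuousAt
  have hf : ∀ q, HasFDerivAt (fun q => F.u p * F.v q - F.v p * F.u q)
      (F.u p • fderiv ℝ F.v q - F.v p • fderiv ℝ F.u q) q := fun q =>
    ((hv q).hasFDerivAt.const_mul _).sub ((hu q).hasFDerivAt.const_mul _)
  have hmix := mixed_partials_eq (a := p)
    (p := fun q => -(pdY F.P q) - g - (F.u q - F.u p) * pdX F.v q + (F.v q - F.v p) * pdX F.u q)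
    (q := fun q => pdX F.P q - (F.u q - F.u p) * pdY F.v q + (F.v q - F.v p) * pdY F.u q)
    (fun q => (hf q).differentiableAt)
    (by
      filter_upwards [F.Ω_open.mem_nhds hp] with q hq
      have h1 := F.euler_y q hq
      have h2 := F.incompressible q hq
      rw [(hf q).fderiv]
      change F.u p * pdX F.v q - F.v p * pdX F.u q = _
      linear_combination h1 - F.v q * h2)
    (by
      filter_upwards [F.Ω_open.mem_nhds hp] with q hq
      have h1 := F.euler_x q hq
      have h2 := F.incompressible q hq
      rw [(hf q).fderiv]
      change F.u p * pdY F.v q - F.v p * pdY F.u q = _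
      linear_combination -h1 + F.u q * h2)
    (((hPy.neg.sub_const g).sub (hU F.v_smooth.continuous_pdX)).add
      (hV F.u_smooth.continuous_pdX))
    ((hPx.sub (hU F.v_smooth.continuous_pdY)).add (hV F.u_smooth.continuous_pdY))
  change -(pdY (pdY F.P) p) - pdX F.v p * pdY F.u p + pdX F.u p * pdY F.v p
    = pdX (pdX F.P) p - pdY F.v p * pdX F.u p + pdY F.u p * pdX F.v p at hmix
  linarith

theorem mem_add_int_mul (F : GenPeriodicFlow g Patm L d) {p : ℝ × ℝ} (hp : p ∈ F.Ω) (n : ℤ) :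
    (p.1 + n * (2 * L), p.2) ∈ F.Ω := by
  have h : Function.Periodic (fun x => (x, p.2) ∈ F.Ω) (2 * L) := fun x =>
    propext (F.Ω_per (x, p.2)).symm
  exact (h.int_mul n p.1).symm ▸ hp

theorem mem_closure_add_int_mul (F : GenPeriodicFlow g Patm L d) {p : ℝ × ℝ}
    (hp : p ∈ closure F.Ω) (n : ℤ) : (p.1 + n * (2 * L), p.2) ∈ closure F.Ω :=
  map_mem_closure (f := fun p : ℝ × ℝ => (p.1 + n * (2 * L), p.2)) (by fun_prop) hp
    fun _ hq => F.mem_add_int_mul hq n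

theorem exists_forall_le (F : GenPeriodicFlow g Patm L d) (hL : 0 < L) {f : ℝ × ℝ → ℝ}
    (hf : ContinuousOn f (closure F.Ω))
    (hper : ∀ p ∈ closure F.Ω, f (p.1 + 2 * L, p.2) = f p) :
    ∃ q ∈ closure F.Ω, ∀ p ∈ closure F.Ω, f q ≤ f p := by
  obtain ⟨hi, hhi⟩ := F.exists_le_of_mem_closure hL
  have hred : ∀ p ∈ closure F.Ω, ∃ p' ∈ closure F.Ω ∩ Icc (0 : ℝ) (2 * L) ×ˢ Icc (-d) hi,
      f p' = f p := by
    intro p hp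
    have h : Function.Periodic (fun x => (closure F.Ω).indicator f (x, p.2)) (2 * L) := fun x => by
      by_cases hx : (x, p.2) ∈ closure F.Ω
      · have := F.mem_closure_add_int_mul hx 1
        simp only [Int.cast_one, one_mul] at this
        simp only [indicator_of_mem hx, indicator_of_mem this]
        exact hper _ hx
      · have hx' : (x + 2 * L, p.2) ∉ closure F.Ω := fun h => hx <| by
          simpa using F.mem_closure_add_int_mul h (-1)
        simp only [indicator_of_notMem hx, indicator_of_notMem hx']
    obtain ⟨n, hn, -⟩ := existsUnique_add_zsmul_mem_Ico (mul_pos two_pos hL) p.1 0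
    rw [zsmul_eq_mul, zero_add] at hn
    have hm := F.mem_closure_add_int_mul hp n
    refine ⟨_, ⟨hm, ⟨hn.1, hn.2.le⟩, F.bed_le hm, hhi _ hm⟩, ?_⟩
    have := h.int_mul n p.1
    simp only [indicator_of_mem hm] at this
    rw [this, indicator_of_mem hp]
  have hK : IsCompact (closure F.Ω ∩ Icc (0 : ℝ) (2 * L) ×ˢ Icc (-d) hi) :=
    (isCompact_Icc.prod isCompact_Icc).inter_left isClosed_closure
  have hne : (closure F.Ω ∩ Icc (0 : ℝ) (2 * L) ×ˢ Icc (-d) hi).Nonempty := by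
    obtain ⟨p, hp⟩ := F.Ω_conn.nonempty
    obtain ⟨p', hp', -⟩ := hred p (subset_closure hp)
    exact ⟨p', hp'⟩
  obtain ⟨q, hq, hmin⟩ := hK.exists_isMinOn hne (hf.mono inter_subset_left)
  refine ⟨q, hq.1, fun p hp => ?_⟩
  obtain ⟨p', hp', h⟩ := hred p hp
  exact (hmin hp').trans_eq h

theorem exists_forall_ge (F : GenPeriodicFlow g Patm L d) (hL : 0 < L) {f : ℝ × ℝ → ℝ}
    (hf : ContinuousOn f (closure F.Ω))
    (hper : ∀ p ∈ closure F.Ω, f (p.1 + 2 * L, p.2) = f p) :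
    ∃ q ∈ closure F.Ω, ∀ p ∈ closure F.Ω, f p ≤ f q := by
  obtain ⟨q, hq, h⟩ := F.exists_forall_le hL hf.neg fun p hp => congrArg Neg.neg (hper p hp)
  exact ⟨q, hq, fun p hp => neg_le_neg_iff.1 (h p hp)⟩

theorem psi_hasFDerivAt (F : GenPeriodicFlow g Patm L d) (p : ℝ × ℝ) :
    HasFDerivAt F.ψ (fderiv ℝ F.ψ p) p :=
  (F.ψ_smooth.differentiable (by norm_num) p).hasFDerivAt

theorem psi_fderiv (F : GenPeriodicFlow g Patm L d) {p : ℝ × ℝ} (hp : p ∈ closure F.Ω)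
    (n : ℝ × ℝ) : fderiv ℝ F.ψ p n = -(n.1 * F.v p) + n.2 * F.u p := by
  rw [fderiv_prod_apply, F.psi_x p hp, F.psi_y p hp]; ring

theorem psi_periodic (F : GenPeriodicFlow g Patm L d) {p : ℝ × ℝ} (hp : p ∈ closure F.Ω) :
    F.ψ (p.1 + 2 * L, p.2) = F.ψ p := by
  set h : ℝ × ℝ → ℝ := fun q => F.ψ (q + (2 * L, 0)) - F.ψ q with hh
  have hd : ∀ q, HasFDerivAt h (fderiv ℝ F.ψ (q + (2 * L, 0)) - fderiv ℝ F.ψ q) q := fun q =>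
    ((hasFDerivAt_comp_add_right _).2 (F.psi_hasFDerivAt (q + (2 * L, 0)))).sub (F.psi_hasFDerivAt q)
  have hadd : ∀ q : ℝ × ℝ, q + (2 * L, 0) = (q.1 + 2 * L, q.2) := fun q => by ext <;> simp
  obtain ⟨c, hc⟩ := F.Ω_open.exists_is_const_of_fderiv_eq_zero (𝕜 := ℝ) F.Ω_conn.isPreconnected
    (f := h) (fun q _ => (hd q).differentiableAt.differentiableWithinAt) fun q hq => by
      have hq2 : (q.1 + 2 * L, q.2) ∈ F.Ω := (F.Ω_per q).1 hq
      rw [(hd q).fderiv, hadd]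
      refine ContinuousLinearMap.ext fun n => ?_
      simp [F.psi_fderiv (subset_closure hq), F.psi_fderiv (subset_closure hq2), F.u_periodic,
        F.v_periodic]
  have hcont : Continuous h := continuous_iff_continuousAt.2 fun q => (hd q).continuousAt
  have hcl : ∀ q ∈ closure F.Ω, h q = c := fun q hq =>
    closure_minimal (t := {q | h q = c}) hc (isClosed_eq hcont continuous_const) hq
  have hs := hcl _ (frontier_subset_closure (F.surf_mem_frontier 0))
  have h0 : c = 0 := by
    rw [← hs, hh]
    simp only [hadd]
    rw [← F.X_per 0, ← F.Y_per 0, F.psi_surface, F.Y_per 0, F.psi_surface, sub_zero]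
  have := hcl p hp
  rw [h0, hh] at this
  simp only [hadd] at this
  exact sub_eq_zero.1 this

theorem not_isLocalExtr_psi (F : GenPeriodicFlow g Patm L d)
    (hstag : ∀ p ∈ closure F.Ω, F.u p ^ 2 + F.v p ^ 2 ≠ 0) {p : ℝ × ℝ} (hp : p ∈ F.Ω) :
    ¬ IsLocalExtr F.ψ p := fun h => by
  have h0 := h.fderiv_eq_zero
  have hc := subset_closure hp
  have h1 := F.psi_x p hc
  have h2 := F.psi_y p hc
  simp only [pdX, pdY, h0, zero_apply] at h1 h2
  apply hstag p hc
  rw [← h2, neg_eq_zero.1 h1.symm]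
  norm_num

/-- Without stagnation points the stream function has a strict sign in the fluid. -/
theorem exists_sign_psi (F : GenPeriodicFlow g Patm L d) (hL : 0 < L)
    (hstag : ∀ p ∈ closure F.Ω, F.u p ^ 2 + F.v p ^ 2 ≠ 0) :
    ∃ σ : ℝ, σ ^ 2 = 1 ∧ ∀ p ∈ F.Ω, 0 < σ * F.ψ p := by
  have hcont := F.ψ_smooth.continuous
  have hbd : ∀ q ∈ closure F.Ω, q ∉ F.Ω → F.ψ q = 0 ∨ F.ψ q = F.m := fun q hq hn => by
    rcases F.mem_closure_cases hq with h | ⟨s, rfl⟩ | h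
    · exact absurd h hn
    · exact Or.inl (F.psi_surface s)
    · exact Or.inr (by rw [← F.psi_bed q.1, ← h])
  have hnhds : ∀ q ∈ F.Ω, ∀ᶠ p in nhds q, p ∈ closure F.Ω := fun q hq =>
    Filter.mem_of_superset (F.Ω_open.mem_nhds hq) subset_closure
  obtain ⟨a, ha, hmin⟩ := F.exists_forall_le hL hcont.continuousOn fun p hp => F.psi_periodic hp
  obtain ⟨b, hb, hmax⟩ := F.exists_forall_ge hL hcont.continuousOn fun p hp => F.psi_periodic hp
  have hno_min : ∀ q ∈ F.Ω, F.ψ q ≠ F.ψ a := fun q hq h =>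
    F.not_isLocalExtr_psi hstag hq <| Or.inl <| by
      filter_upwards [hnhds q hq] with p hp
      rw [h]; exact hmin p hp
  have hno_max : ∀ q ∈ F.Ω, F.ψ q ≠ F.ψ b := fun q hq h =>
    F.not_isLocalExtr_psi hstag hq <| Or.inr <| by
      filter_upwards [hnhds q hq] with p hp
      rw [h]; exact hmax p hp
  have hlt : ∀ q ∈ F.Ω, F.ψ a < F.ψ q ∧ F.ψ q < F.ψ b := fun q hq =>
    ⟨lt_of_le_of_ne (hmin q (subset_closure hq)) (hno_min q hq).symm,
      lt_of_le_of_ne (hmax q (subset_closure hq)) (hno_max q hq)⟩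
  have ha' := hbd a ha fun h => hno_min a h rfl
  have hb' := hbd b hb fun h => hno_max b h rfl
  obtain ⟨q, hq⟩ := F.Ω_conn.nonempty
  rcases ha' with ha' | ha'
  · exact ⟨1, by norm_num, fun p hp => by linarith [(hlt p hp).1]⟩
  · rcases hb' with hb' | hb'
    · exact ⟨-1, by norm_num, fun p hp => by linarith [(hlt p hp).2]⟩
    · linarith [(hlt q hq).1, (hlt q hq).2]

theorem pdY_pressure_bed (F : GenPeriodicFlow g Patm L d) (x : ℝ) : pdY F.P (x, -d) = -g := by
  have hx : pdX F.v (x, -d) = 0 := by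
    have h := (F.v_smooth.differentiable (by norm_num) (x, -d)).hasFDerivAt.hasDerivAt_fst
    simp only [F.bed_kinematic] at h
    exact h.unique (hasDerivAt_const x 0)
  have hcl : (x, -d) ∈ {p | F.u p * pdX F.v p + F.v p * pdY F.v p = -(pdY F.P p) - g} := by
    refine closure_minimal (fun p hp => F.euler_y p hp) (isClosed_eq ?_ ?_)
      (frontier_subset_closure (F.bed_mem_frontier x))
    · exact (F.u_smooth.continuous.mul F.v_smooth.continuous_pdX).add
        (F.v_smooth.continuous.mul F.v_smooth.continuous_pdY)
    · exact (F.P_smooth.differentiable_pdY.continuous.neg).sub continuous_const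
  simp only [mem_ofPred_eq, hx, F.bed_kinematic] at hcl
  linarith

end GenPeriodicFlow

/-- The differential inequality behind the pressure barrier: at a critical point of
`P - κ exp (α σ ψ)` the Laplacian is negative once `α` is large. -/
theorem barrier_laplacian_neg {g u v ux uy vx vy Px Py ΔP K α σ : ℝ} (hK : 0 < K) (hg : 0 < g)
    (hσ : σ ^ 2 = 1) (hQ : 0 < u ^ 2 + v ^ 2)
    (hx : u * ux + v * uy = -Px) (hy : u * vx + v * vy = -Py - g) (hdiv : ux + vy = 0)
    (hΔ : ΔP = 2 * (ux * vy - uy * vx)) (hfav : 0 ≤ (vx - uy) * u + g)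
    (hPx : Px = -(K * σ * v)) (hPy : Py = K * σ * u)
    (hα : (4 * g * |u| / (u ^ 2 + v ^ 2) + |vx - uy|) / (u ^ 2 + v ^ 2) < α) :
    ΔP - K * α * (u ^ 2 + v ^ 2) + K * σ * (vx - uy) < 0 := by
  set Q := u ^ 2 + v ^ 2 with hQdef
  have hα' : 4 * g * |u| + |vx - uy| * Q < α * Q ^ 2 := by
    have := (div_lt_iff₀ hQ).1 hα
    have h2 := mul_lt_mul_of_pos_right this hQ
    rw [add_mul, div_mul_cancel₀ _ hQ.ne'] at h2
    linarith
  have hσabs : |σ| = 1 := by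
    rw [← sq_eq_sq₀ (abs_nonneg _) zero_le_one, sq_abs, hσ, one_pow]
  have h1 : -(σ * u) ≤ |u| := by
    simpa [abs_mul, hσabs] using neg_le_abs (σ * u)
  have h2 : -(σ * (vx - uy)) ≤ |vx - uy| := by
    simpa [abs_mul, hσabs] using neg_le_abs (σ * (vx - uy))
  have h3 : Q * ΔP = -2 * (Px * (Px - (vx - uy) * v) + Py * (Py + 2 * g + (vx - uy) * u)
      + g * ((vx - uy) * u + g)) := by
    have e1 : Px = -(u * ux + v * uy) := by linarith
    have e2 : Py = -g - (u * vx + v * vy) := by linarith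
    have e3 : vy = -ux := by linarith
    rw [hΔ, e1, e2, e3, hQdef]
    ring
  have h4 : Q * (ΔP - K * α * Q + K * σ * (vx - uy))
      = K * (-(4 * g * (σ * u)) - σ * (vx - uy) * Q - α * Q ^ 2) - 2 * K ^ 2 * Q
        - 2 * g * ((vx - uy) * u + g) := by
    rw [mul_add, mul_sub, h3, hPx, hPy, hQdef]
    linear_combination (-2 * K ^ 2 * (u ^ 2 + v ^ 2)) * hσ
  have h5 : -(4 * g * (σ * u)) - σ * (vx - uy) * Q - α * Q ^ 2 < 0 := by
    have := mul_le_mul_of_nonneg_left h1 (by positivity : (0 : ℝ) ≤ 4 * g)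
    have := mul_le_mul_of_nonneg_right h2 hQ.le
    linarith
  have h6 : Q * (ΔP - K * α * Q + K * σ * (vx - uy)) < 0 := by
    rw [h4]
    have := mul_neg_of_pos_of_neg hK h5
    have : 0 < 2 * K ^ 2 * Q := by positivity
    have : 0 ≤ 2 * g * ((vx - uy) * u + g) := by positivity
    linarith
  exact neg_of_mul_neg_right h6 hQ.le

theorem fderiv_eq_of_periodic {f : ℝ × ℝ → ℝ} {c : ℝ} (hf : ∀ x y, f (x + c, y) = f (x, y))
    (x y : ℝ) : fderiv ℝ f (x + c, y) = fderiv ℝ f (x, y) := by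
  have h : (fun q => f (q + (c, 0))) = f := funext fun q => by
    rw [show q + (c, 0) = (q.1 + c, q.2) by ext <;> simp]
    exact hf q.1 q.2
  have h2 := fderiv_comp_add_right (𝕜 := ℝ) (f := f) (x := (x, y)) (c, 0)
  rw [h] at h2
  simpa using h2.symm

namespace GenPeriodicFlow

variable {g Patm L d : ℝ}

/-- A point of `Ω` cannot minimize `P - κ exp (α σ ψ)` over the fluid once `α` is large. -/
theorem not_isLocalMin_barrier (F : GenPeriodicFlow g Patm L d) (hg : 0 < g) {κ α σ : ℝ}
    (hκ : 0 < κ) (hα0 : 0 < α) (hσ : σ ^ 2 = 1) {p : ℝ × ℝ} (hp : p ∈ F.Ω)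
    (hstag : F.u p ^ 2 + F.v p ^ 2 ≠ 0) (hfav : 0 ≤ F.vort p * F.u p + g)
    (hα : (4 * g * |F.u p| / (F.u p ^ 2 + F.v p ^ 2) + |F.vort p|) / (F.u p ^ 2 + F.v p ^ 2) < α) :
    ¬ IsLocalMin (fun q => F.P q - κ * Real.exp (α * (σ * F.ψ q))) p := by
  intro hmin
  obtain ⟨x, y⟩ := p
  have hP : Differentiable ℝ F.P := F.P_smooth.differentiable (by norm_num)
  have hu : Differentiable ℝ F.u := F.u_smooth.differentiable (by norm_num)
  have hv : Differentiable ℝ F.v := F.v_smooth.differentiable (by norm_num)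
  have hcx : ContinuousAt (fun t : ℝ => (t, y)) x := by fun_prop
  have hcy : ContinuousAt (fun t : ℝ => (x, t)) y := by fun_prop
  have hΩ := F.Ω_open.mem_nhds hp
  have hEx : ∀ t, (t, y) ∈ F.Ω → HasDerivAt (fun t => Real.exp (α * (σ * F.ψ (t, y))))
      (Real.exp (α * (σ * F.ψ (t, y))) * (α * (σ * -F.v (t, y)))) t := fun t ht => by
    have h := (F.psi_hasFDerivAt (t, y)).hasDerivAt_fst
    rw [show fderiv ℝ F.ψ (t, y) (1, 0) = -F.v (t, y) from F.psi_x _ (subset_closure ht)] at h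
    exact ((h.const_mul σ).const_mul α).exp
  have hEy : ∀ t, (x, t) ∈ F.Ω → HasDerivAt (fun t => Real.exp (α * (σ * F.ψ (x, t))))
      (Real.exp (α * (σ * F.ψ (x, t))) * (α * (σ * F.u (x, t)))) t := fun t ht => by
    have h := (F.psi_hasFDerivAt (x, t)).hasDerivAt_snd
    rw [show fderiv ℝ F.ψ (x, t) (0, 1) = F.u (x, t) from F.psi_y _ (subset_closure ht)] at h
    exact ((h.const_mul σ).const_mul α).exp
  have hx1 : ∀ t, (t, y) ∈ F.Ω → HasDerivAt
      (fun t => F.P (t, y) - κ * Real.exp (α * (σ * F.ψ (t, y))))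
      (pdX F.P (t, y) - κ * (Real.exp (α * (σ * F.ψ (t, y))) * (α * (σ * -F.v (t, y))))) t :=
    fun t ht => (hP (t, y)).hasFDerivAt.hasDerivAt_fst.sub ((hEx t ht).const_mul κ)
  have hy1 : ∀ t, (x, t) ∈ F.Ω → HasDerivAt
      (fun t => F.P (x, t) - κ * Real.exp (α * (σ * F.ψ (x, t))))
      (pdY F.P (x, t) - κ * (Real.exp (α * (σ * F.ψ (x, t))) * (α * (σ * F.u (x, t))))) t :=
    fun t ht => (hP (x, t)).hasFDerivAt.hasDerivAt_snd.sub ((hEy t ht).const_mul κ)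
  have hx2 := (F.P_smooth.differentiable_pdX (x, y)).hasFDerivAt.hasDerivAt_fst.sub
    (((hEx x hp).mul
      (((hv (x, y)).hasFDerivAt.hasDerivAt_fst.neg.const_mul σ).const_mul α)).const_mul κ)
  have hy2 := (F.P_smooth.differentiable_pdY (x, y)).hasFDerivAt.hasDerivAt_snd.sub
    (((hEy y hp).mul
      (((hu (x, y)).hasFDerivAt.hasDerivAt_snd.const_mul σ).const_mul α)).const_mul κ)
  have hminx : IsLocalMin (fun t => F.P (t, y) - κ * Real.exp (α * (σ * F.ψ (t, y)))) x :=
    hcx.eventually hmin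
  have hminy : IsLocalMin (fun t => F.P (x, t) - κ * Real.exp (α * (σ * F.ψ (x, t)))) y :=
    hcy.eventually hmin
  have hx3 := nonneg_of_isLocalMin_of_hasDerivAt_hasDerivAt
    ((hcx.eventually hΩ).mono hx1) hx2 hminx
  have hy3 := nonneg_of_isLocalMin_of_hasDerivAt_hasDerivAt
    ((hcy.eventually hΩ).mono hy1) hy2 hminy
  have hx4 := hminx.hasDerivAt_eq_zero (hx1 x hp)
  have hy4 := hminy.hasDerivAt_eq_zero (hy1 y hp)
  have hlap := F.pressure_laplacian hp
  set E := Real.exp (α * (σ * F.ψ (x, y))) with hE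
  have hE0 : 0 < E := Real.exp_pos _
  have hneg := barrier_laplacian_neg (K := κ * E * α) (σ := σ) (by positivity) hg hσ
    (lt_of_le_of_ne (by positivity) hstag.symm) (F.euler_x _ hp) (F.euler_y _ hp)
    (F.incompressible _ hp) hlap hfav (by linarith) (by linarith) hα
  change 0 ≤ pdX (pdX F.P) (x, y) - κ * (E * (α * (σ * -F.v (x, y))) * (α * (σ * -F.v (x, y)))
    + E * (α * (σ * -pdX F.v (x, y)))) at hx3
  change 0 ≤ pdY (pdY F.P) (x, y) - κ * (E * (α * (σ * F.u (x, y))) * (α * (σ * F.u (x, y)))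
    + E * (α * (σ * pdY F.u (x, y)))) at hy3
  have hsum : pdX (pdX F.P) (x, y) + pdY (pdY F.P) (x, y)
      - κ * E * α * α * (F.u (x, y) ^ 2 + F.v (x, y) ^ 2)
      + κ * E * α * σ * (pdX F.v (x, y) - pdY F.u (x, y))
      = (pdX (pdX F.P) (x, y) - κ * (E * (α * (σ * -F.v (x, y))) * (α * (σ * -F.v (x, y)))
        + E * (α * (σ * -pdX F.v (x, y)))))
      + (pdY (pdY F.P) (x, y) - κ * (E * (α * (σ * F.u (x, y))) * (α * (σ * F.u (x, y)))
        + E * (α * (σ * pdY F.u (x, y))))) := by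
    linear_combination (κ * E * α * α * (F.u (x, y) ^ 2 + F.v (x, y) ^ 2)) * hσ
  linarith

/-- The pressure dominates an exponential barrier in the stream function. -/
theorem exists_barrier (F : GenPeriodicFlow g Patm L d) (hg : 0 < g) (hL : 0 < L) {σ : ℝ}
    (hσ : σ ^ 2 = 1) (hstag : ∀ p ∈ closure F.Ω, F.u p ^ 2 + F.v p ^ 2 ≠ 0)
    (hfav : ∀ p ∈ F.Ω, 0 ≤ F.vort p * F.u p + g) :
    ∃ κ α : ℝ, 0 < κ ∧ 0 < α ∧
      ∀ p ∈ closure F.Ω, Patm + κ * (Real.exp (α * (σ * F.ψ p)) - 1) ≤ F.P p := by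
  have huc := F.u_smooth.continuous
  have hvc := F.v_smooth.continuous
  have hψc := F.ψ_smooth.continuous
  have hωc : Continuous F.vort := F.v_smooth.continuous_pdX.sub F.u_smooth.continuous_pdY
  have hωp : ∀ p : ℝ × ℝ, F.vort (p.1 + 2 * L, p.2) = F.vort p := fun p => by
    simp only [vort, pdX, pdY, fderiv_eq_of_periodic F.u_periodic,
      fderiv_eq_of_periodic F.v_periodic]
  obtain ⟨a, ha, hamax⟩ := F.exists_forall_ge hL
    (f := fun p => (4 * g * |F.u p| / (F.u p ^ 2 + F.v p ^ 2) + |F.vort p|)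
      / (F.u p ^ 2 + F.v p ^ 2))
    (((ContinuousOn.div (by fun_prop) (by fun_prop) hstag).add (by fun_prop)).div
      (by fun_prop) hstag)
    (fun p _ => by simp only [F.u_periodic, F.v_periodic, hωp])
  obtain ⟨α, hα0, hα⟩ : ∃ α : ℝ, 0 < α ∧ ∀ p ∈ closure F.Ω,
      (4 * g * |F.u p| / (F.u p ^ 2 + F.v p ^ 2) + |F.vort p|) / (F.u p ^ 2 + F.v p ^ 2) < α :=
    ⟨_, add_pos_of_nonneg_of_pos (by positivity) one_pos,
      fun p hp => (hamax p hp).trans_lt (lt_add_one _)⟩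
  obtain ⟨b, hb, hbmax⟩ := F.exists_forall_ge hL
    (f := fun p => α * |F.u p| * Real.exp (α * (σ * F.ψ p))) (by fun_prop)
    (fun p hp => by simp only [F.u_periodic, F.psi_periodic hp])
  obtain ⟨κ, hκ0, hκ⟩ : ∃ κ : ℝ, 0 < κ ∧ ∀ p ∈ closure F.Ω,
      κ * (α * |F.u p| * Real.exp (α * (σ * F.ψ p))) < g := by
    set M := α * |F.u b| * Real.exp (α * (σ * F.ψ b))
    have hM : 0 < M + 1 := by positivity
    refine ⟨g / (M + 1), by positivity, fun p hp => ?_⟩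
    rw [div_mul_eq_mul_div, div_lt_iff₀ hM]
    exact mul_lt_mul_of_pos_left ((hbmax p hp).trans_lt (lt_add_one _)) hg
  refine ⟨κ, α, hκ0, hα0, ?_⟩
  set W : ℝ × ℝ → ℝ := fun q => F.P q - κ * Real.exp (α * (σ * F.ψ q)) with hW
  have hPc := F.P_smooth.continuous
  obtain ⟨q, hq, hmin⟩ := F.exists_forall_le hL (f := W) (by fun_prop)
    (fun p hp => by simp only [hW, F.P_periodic, F.psi_periodic hp])
  rcases F.mem_closure_cases hq with h | ⟨s, rfl⟩ | h
  · refine absurd ?_ (F.not_isLocalMin_barrier hg hκ0 hα0 hσ h (hstag q hq) (hfav q h) (hα q hq))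
    filter_upwards [F.Ω_open.mem_nhds h] with p hp
    exact hmin p (subset_closure hp)
  · intro p hp
    have := hmin p hp
    simp only [hW, F.surface_pressure, F.psi_surface, mul_zero, Real.exp_zero] at this
    linarith
  · obtain ⟨x, y⟩ := q
    simp only at h
    subst h
    exfalso
    have hP := (F.P_smooth.differentiable (by norm_num) (x, -d)).hasFDerivAt.hasDerivAt_snd
    have hψ := (F.psi_hasFDerivAt (x, -d)).hasDerivAt_snd
    rw [show fderiv ℝ F.ψ (x, -d) (0, 1) = F.u (x, -d) from F.psi_y _ hq] at hψ
    rw [show fderiv ℝ F.P (x, -d) (0, 1) = -g from F.pdY_pressure_bed x] at hP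
    have hd := hP.sub ((((hψ.const_mul σ).const_mul α).exp).const_mul κ)
    obtain ⟨lo, hi, hlo, hY⟩ := F.exists_surf_bounds
    have h0 := hd.nonneg_of_eventually_right_le (by
      filter_upwards [Ioo_mem_nhdsGT (show (0 : ℝ) < lo + d by linarith)] with t ht
      exact hmin (x, -d + t) (subset_closure (F.mem_of_lt_surf (fun s => (hY s).1)
        (by simp only; linarith [ht.1]) (by simp only; linarith [ht.2]))))
    have hlt := hκ _ hq
    have hσabs : |σ| = 1 := by
      rw [← sq_eq_sq₀ (abs_nonneg _) zero_le_one, sq_abs, hσ, one_pow]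
    have h1 : -(σ * F.u (x, -d)) ≤ |F.u (x, -d)| := by
      simpa [abs_mul, hσabs] using neg_le_abs (σ * F.u (x, -d))
    have hE := Real.exp_pos (α * (σ * F.ψ (x, -d)))
    have := mul_le_mul_of_nonneg_left h1
      (by positivity : 0 ≤ κ * (α * Real.exp (α * (σ * F.ψ (x, -d)))))
    nlinarith

/-- From a surface point, the direction in which `σ ψ` increases points into the fluid. -/
theorem eventually_mem_closure (F : GenPeriodicFlow g Patm L d)
    (hstag : ∀ p ∈ closure F.Ω, F.u p ^ 2 + F.v p ^ 2 ≠ 0) {σ : ℝ} (hσ : σ ^ 2 = 1)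
    (hpos : ∀ p ∈ F.Ω, 0 < σ * F.ψ p) (s : ℝ) :
    ∀ᶠ t in nhdsWithin (0 : ℝ) (Ioi 0),
      (F.X s, F.Y s) + t • ((-(σ * F.v (F.X s, F.Y s)), σ * F.u (F.X s, F.Y s)) : ℝ × ℝ)
        ∈ closure F.Ω := by
  set p : ℝ × ℝ := (F.X s, F.Y s) with hp
  set e : ℝ × ℝ := (-(σ * F.v p), σ * F.u p) with he
  have hpc : p ∈ closure F.Ω := frontier_subset_closure (F.surf_mem_frontier s)
  have hcont : Continuous fun q => σ * fderiv ℝ F.ψ q e :=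
    continuous_const.mul ((F.ψ_smooth.continuous_fderiv (by norm_num)).clm_apply continuous_const)
  have hp1 : 0 < σ * fderiv ℝ F.ψ p e := by
    rw [F.psi_fderiv hpc, he]
    have : σ * (-(-(σ * F.v p) * F.v p) + σ * F.u p * F.u p) = F.u p ^ 2 + F.v p ^ 2 := by
      linear_combination (F.u p ^ 2 + F.v p ^ 2) * hσ
    simp only [this]
    exact lt_of_le_of_ne (by positivity) (hstag p hpc).symm
  obtain ⟨r, hr, hball⟩ := Metric.mem_nhds_iff.1 <| Filter.inter_mem
    (hcont.continuousAt.eventually_const_lt hp1 : {q | 0 < σ * fderiv ℝ F.ψ q e} ∈ nhds p)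
    (continuous_snd.continuousAt.eventually_const_lt (F.S_above_bed s) :
      {q : ℝ × ℝ | -d < q.2} ∈ nhds p)
  have hsmall : ∀ᶠ t in nhdsWithin (0 : ℝ) (Ioi 0), ‖t • e‖ < r / 2 := by
    have hc : Continuous fun t : ℝ => ‖t • e‖ := by fun_prop
    have h0 : ‖(0 : ℝ) • e‖ < r / 2 := by simpa using hr
    exact (hc.continuousAt.eventually_lt_const h0).filter_mono nhdsWithin_le_nhds
  filter_upwards [hsmall, self_mem_nhdsWithin] with τ hτ hτ0
  have hτ0' : 0 < τ := hτ0
  refine Metric.mem_closure_iff.2 fun ε hε => ?_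
  obtain ⟨q, hq, hqd⟩ := Metric.mem_closure_iff.1 hpc (min ε (r / 2)) (lt_min hε (half_pos hr))
  have hline : ∀ t ∈ Icc 0 τ, q + t • e ∈ Metric.ball p r := fun t ht => by
    have h1 : ‖t • e‖ ≤ ‖τ • e‖ := by
      rw [norm_smul, norm_smul, Real.norm_of_nonneg ht.1, Real.norm_of_nonneg hτ0'.le]
      exact mul_le_mul_of_nonneg_right ht.2 (norm_nonneg _)
    have h2 : dist q p < r / 2 := by rw [dist_comm]; exact hqd.trans_le (min_le_right _ _)
    rw [Metric.mem_ball, dist_eq_norm, add_sub_right_comm]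
    rw [dist_eq_norm] at h2
    linarith [norm_add_le (q - p) (t • e)]
  have hder : ∀ t, HasDerivAt (fun t : ℝ => σ * F.ψ (q + t • e))
      (σ * fderiv ℝ F.ψ (q + t • e) e) t := fun t => by
    have h1 : HasDerivAt (fun t : ℝ => q + t • e) e t := by
      simpa using ((hasDerivAt_id t).smul_const e).const_add q
    exact ((F.psi_hasFDerivAt _).comp_hasDerivAt t h1).const_mul σ
  have hmono : StrictMonoOn (fun t : ℝ => σ * F.ψ (q + t • e)) (Icc 0 τ) := by
    refine strictMonoOn_of_deriv_pos (convex_Icc _ _)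
      (fun t _ => (hder t).continuousAt.continuousWithinAt) fun t ht => ?_
    rw [(hder t).deriv]
    exact (hball (hline t (interior_subset ht))).1
  refine ⟨q + τ • e, ?_, ?_⟩
  · refine F.subset_of_isPreconnected (C := (fun t : ℝ => q + t • e) '' Icc 0 τ)
      (isPreconnected_Icc.image _ (by fun_prop)) ⟨q, ⟨0, ⟨le_rfl, hτ0'.le⟩, by simp⟩, hq⟩ ?_ ?_
      ⟨τ, ⟨hτ0'.le, le_rfl⟩, rfl⟩
    · rintro _ ⟨t, ht, rfl⟩ s' hs'
      have h1 := hmono.monotoneOn ⟨le_rfl, hτ0'.le⟩ ht ht.1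
      simp only [hs', F.psi_surface, zero_smul, add_zero] at h1
      linarith [hpos q hq]
    · rintro _ ⟨t, ht, rfl⟩
      exact (hball (hline t ht)).2.ne'
  · rw [dist_add_right]
    exact hqd.trans_le (min_le_left _ _)

/-- An outward normal is a negative multiple of the gradient of `σ ψ`. -/
theorem exists_neg_smul_of_isOutwardNormalAt (F : GenPeriodicFlow g Patm L d)
    (hstag : ∀ p ∈ closure F.Ω, F.u p ^ 2 + F.v p ^ 2 ≠ 0) {σ : ℝ} (hσ : σ ^ 2 = 1)
    (hpos : ∀ p ∈ F.Ω, 0 < σ * F.ψ p) {s : ℝ} {n : ℝ × ℝ} (hn : F.IsOutwardNormalAt n s) :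
    ∃ c : ℝ, c < 0 ∧ n = c • ((-(σ * F.v (F.X s, F.Y s)), σ * F.u (F.X s, F.Y s)) : ℝ × ℝ) := by
  have hpc := frontier_subset_closure (F.surf_mem_frontier s)
  have hev := F.eventually_mem_closure hstag hσ hpos s
  have htan := F.surface_tangency s
  have hQ := hstag _ hpc
  obtain ⟨horth, t₀, ht₀, hout⟩ := hn
  have hreg := F.regular s
  set u := F.u (F.X s, F.Y s)
  set v := F.v (F.X s, F.Y s)
  set X' := deriv F.X s
  set Y' := deriv F.Y s
  have hpar : n.1 * u + n.2 * v = 0 := by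
    have h1 : (X' ^ 2 + Y' ^ 2) * (n.1 * u + n.2 * v) = 0 := by
      linear_combination (X' * u + Y' * v) * horth + (n.1 * Y' - n.2 * X') * htan
    exact (mul_eq_zero.1 h1).resolve_left hreg
  set c : ℝ := σ * (n.2 * u - n.1 * v) / (u ^ 2 + v ^ 2) with hc
  have hnc : n = c • ((-(σ * v), σ * u) : ℝ × ℝ) := by
    ext
    · simp only [hc, Prod.smul_mk, smul_eq_mul]
      field_simp
      linear_combination (-v * (n.1 * v - n.2 * u)) * hσ + u * hpar
    · simp only [hc, Prod.smul_mk, smul_eq_mul]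
      field_simp
      linear_combination (-u * (n.2 * u - n.1 * v)) * hσ + v * hpar
  refine ⟨c, ?_, hnc⟩
  by_contra! hc0
  have heq : ∀ t : ℝ, (F.X s + t * n.1, F.Y s + t * n.2)
      = (F.X s, F.Y s) + (t * c) • ((-(σ * v), σ * u) : ℝ × ℝ) := fun t => by
    rw [mul_smul, ← hnc]; ext <;> simp
  rcases hc0.eq_or_lt with hc0 | hc0
  · refine hout (t₀ / 2) (half_pos ht₀) (half_lt_self ht₀) ?_
    rw [heq, ← hc0]
    simpa using hpc
  · obtain ⟨δ, hδ, hsub⟩ := mem_nhdsGT_iff_exists_Ioo_subset.1 hev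
    have hδ' : 0 < δ := hδ
    have ht : 0 < min t₀ (δ / c) := lt_min ht₀ (div_pos hδ' hc0)
    refine hout (min t₀ (δ / c) / 2) (half_pos ht) ((half_lt_self ht).trans_le (min_le_left _ _)) ?_
    rw [heq]
    refine hsub ⟨mul_pos (half_pos ht) hc0, ?_⟩
    rw [← lt_div_iff₀ hc0]
    exact (half_lt_self ht).trans_le (min_le_right _ _)

end GenPeriodicFlow

/-- **Pressure with favorable vortex force.**  For a nontrivial flow with no stagnation
points in the closure of `Ω`, if `ω u + g ≥ 0` throughout `Ω` then `P ≥ Patm` on the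
closure of `Ω`, with equality only on the free surface `S`, and the outward normal
derivative of `P` is strictly negative at every point of `S`. -/
theorem pressure_ge_atmospheric_of_favorable (g Patm L d : ℝ) (hg : 0 < g) (hL : 0 < L)
    (hd : 0 < d)
    (F : GenPeriodicFlow g Patm L d)
    (hnt : F.Nontrivial')
    (hstag : ∀ p ∈ closure F.Ω, F.u p ^ 2 + F.v p ^ 2 ≠ 0)
    (hfav : ∀ p ∈ F.Ω, 0 ≤ F.vort p * F.u p + g) :
    (∀ p ∈ closure F.Ω, Patm ≤ F.P p) ∧
    (∀ p ∈ closure F.Ω, F.P p = Patm → ∃ s, p = (F.X s, F.Y s)) ∧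
    (∀ s, ∀ n : ℝ × ℝ, F.IsOutwardNormalAt n s → fderiv ℝ F.P (F.X s, F.Y s) n < 0) := by
  obtain ⟨σ, hσ, hpos⟩ := F.exists_sign_psi hL hstag
  obtain ⟨κ, α, hκ, hα, hbar⟩ := F.exists_barrier hg hL hσ hstag hfav
  have hnonneg : ∀ p ∈ closure F.Ω, 0 ≤ σ * F.ψ p := fun p hp =>
    closure_minimal (t := {q | 0 ≤ σ * F.ψ q}) (fun q hq => (hpos q hq).le)
      (isClosed_le continuous_const (continuous_const.mul F.ψ_smooth.continuous)) hp
  have hge : ∀ p ∈ closure F.Ω, Patm ≤ F.P p := fun p hp => by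
    have h1 := Real.one_le_exp (mul_nonneg hα.le (hnonneg p hp))
    have := mul_nonneg hκ.le (sub_nonneg.2 h1)
    linarith [hbar p hp]
  refine ⟨hge, fun p hp hpP => ?_, fun s n hn => ?_⟩
  · rcases F.mem_closure_cases hp with h | h | h
    · have h1 := Real.one_lt_exp_iff.2 (mul_pos hα (hpos p h))
      have := mul_pos hκ (sub_pos.2 h1)
      linarith [hbar p hp]
    · exact h
    · exfalso
      obtain ⟨x, y⟩ := p
      simp only at h
      subst h
      obtain ⟨lo, hi, hlo, hY⟩ := F.exists_surf_bounds
      have hP := (F.P_smooth.differentiable (by norm_num) (x, -d)).hasFDerivAt.hasDerivAt_snd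
      rw [show fderiv ℝ F.P (x, -d) (0, 1) = -g from F.pdY_pressure_bed x] at hP
      have := hP.nonneg_of_eventually_right_le (by
        filter_upwards [Ioo_mem_nhdsGT (show (0 : ℝ) < lo + d by linarith)] with t ht
        rw [hpP]
        exact hge _ (subset_closure (F.mem_of_lt_surf (fun s => (hY s).1)
          (by simp only; linarith [ht.1]) (by simp only; linarith [ht.2]))))
      linarith
  · obtain ⟨c, hc, rfl⟩ := F.exists_neg_smul_of_isOutwardNormalAt hstag hσ hpos hn
    have hev := F.eventually_mem_closure hstag hσ hpos s
    have hpc := frontier_subset_closure (F.surf_mem_frontier s)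
    have hQ := hstag _ hpc
    set p : ℝ × ℝ := (F.X s, F.Y s) with hp
    set e : ℝ × ℝ := (-(σ * F.v p), σ * F.u p) with he
    have h1 : HasDerivAt (fun t : ℝ => p + t • e) e 0 := by
      simpa using ((hasDerivAt_id (0 : ℝ)).smul_const e).const_add p
    have hp0 : p + (0 : ℝ) • e = p := by simp
    have hP : HasFDerivAt F.P (fderiv ℝ F.P p) (p + (0 : ℝ) • e) := by
      rw [hp0]; exact (F.P_smooth.differentiable (by norm_num) p).hasFDerivAt
    have hψ : HasFDerivAt F.ψ (fderiv ℝ F.ψ p) (p + (0 : ℝ) • e) := by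
      rw [hp0]; exact F.psi_hasFDerivAt p
    have hd := (hP.comp_hasDerivAt 0 h1).sub
      (((((hψ.comp_hasDerivAt 0 h1).const_mul σ).const_mul α).exp).const_mul κ)
    have h0 := hd.nonneg_of_eventually_right_le (by
      filter_upwards [hev] with t ht
      have := hbar _ ht
      simp only [Pi.sub_apply, Function.comp_apply, zero_add, hp0]
      rw [show F.P p = Patm from F.surface_pressure s, show F.ψ p = 0 from F.psi_surface s]
      simp only [mul_zero, Real.exp_zero]
      linarith)
    simp only [Function.comp_apply, hp0, F.psi_fderiv hpc] at h0
    rw [show F.ψ p = 0 from F.psi_surface s] at h0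
    simp only [mul_zero, Real.exp_zero, one_mul] at h0
    have hsq : σ * (-(e.1 * F.v p) + e.2 * F.u p) = F.u p ^ 2 + F.v p ^ 2 := by
      simp only [he]
      linear_combination (F.u p ^ 2 + F.v p ^ 2) * hσ
    rw [hsq] at h0
    have hQ0 : 0 < F.u p ^ 2 + F.v p ^ 2 := lt_of_le_of_ne (by positivity) hQ.symm
    have : 0 < κ * (α * (F.u p ^ 2 + F.v p ^ 2)) := by positivity
    rw [map_smul, smul_eq_mul]
    exact mul_neg_of_neg_of_pos hc (by linarith)
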